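/- For every fixed k and d = 2^{d'} there is a constant C (depending only on k and d) such that for every ε ∈ (0,1), every n ≥ C·ε^{−3}, and every k-local Hamiltonian H on n qudits of local dimension d with m interactions each of operator norm ‖h_e‖_∞ ≤ 1, there exists a Hamiltonian H_D which is a sum of at most C·ε^{−2} complete bipartite sub-Hamiltonians such that ‖H − H_D‖_∞ ≤ ε·n^{k/2}·√m. -/

import Mathlib

open scoped BigOperators ComplexOrder

noncomputable section

namespace QLH

/-- The operator (spectral) norm of a square complex matrix. -/
def opNorm {m : Type*} [Fintype m] [DecidableEq m] (A : Matrix m m ℂ) : ℝ :=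
  ‖Matrix.toEuclideanCLM (𝕜 := ℂ) A‖

/-- A density matrix: positive semidefinite with unit trace. -/
def IsDensity {m : Type*} [Fintype m] (ρ : Matrix m m ℂ) : Prop :=
  ρ.PosSemidef ∧ ρ.trace = 1

/-- The (real) energy `Tr[Hρ]`. -/
def energy {m : Type*} [Fintype m] (H ρ : Matrix m m ℂ) : ℝ :=
  ((H * ρ).trace).re

/-- `A` acts (nontrivially) only on the sites in `e`. -/
def ActsOn {n : ℕ} {α : Type*} [Fintype α] [DecidableEq α]
    (A : Matrix (Fin n → α) (Fin n → α) ℂ) (e : Finset (Fin n)) : Prop :=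
  ∃ M : Matrix ({u // u ∈ e} → α) ({u // u ∈ e} → α) ℂ,
    ∀ x y, A x y =
      (if ∀ u ∉ e, x u = y u then (1 : ℂ) else 0) *
        M (fun u => x u.1) (fun u => y u.1)

/-- Tensor-product (product) state built from single-site matrices. -/
def prodState {n : ℕ} {α : Type*} [Fintype α] (σ : Fin n → Matrix α α ℂ) :
    Matrix (Fin n → α) (Fin n → α) ℂ :=
  fun x y => ∏ u, σ u (x u) (y u)

/-- The Pauli matrices: `σ_0 = I`, `σ_1 = X`, `σ_2 = Y`, `σ_3 = Z`. -/
def pauli : Fin 4 → Matrix (Fin 2) (Fin 2) ℂ :=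
  ![1, !![0, 1; 1, 0], !![0, -Complex.I; Complex.I, 0], !![1, 0; 0, -1]]

/-- On `n` qudits each made of `d'` qubits (local dimension `d = 2^{d'}`), the operator
`σ^c_e = σ^{c_1}_{e_1} ⊗ ⋯ ⊗ σ^{c_k}_{e_k}` for a color `c` (a `k`-tuple of single-qudit
Pauli-basis elements) placed at the distinct sites `e_1, …, e_k`. -/
def sigmaTensor {n k d' : ℕ} (c : Fin k → Fin d' → Fin 4) (e : Fin k → Fin n) :
    Matrix (Fin n → Fin d' → Fin 2) (Fin n → Fin d' → Fin 2) ℂ :=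
  fun x y =>
    (∏ j : Fin k, ∏ t : Fin d', pauli (c j t) (x (e j) t) (y (e j) t)) *
      ∏ w : Fin n, if ∃ j, e j = w then (1 : ℂ) else if x w = y w then 1 else 0

/-- A complete bipartite sub-Hamiltonian of color `c`, weight `a`, and vertex sets
`S 1, …, S k`: the operator `a · ∑ σ^c_e`, summed over all `k`-tuples `e` of distinct
vertices with `e j ∈ S j` for each `j`. -/
def cbsH {n k d' : ℕ} (c : Fin k → Fin d' → Fin 4) (a : ℝ) (S : Fin k → Finset (Fin n)) :
    Matrix (Fin n → Fin d' → Fin 2) (Fin n → Fin d' → Fin 2) ℂ :=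
  (a : ℂ) •
    ∑ e ∈ Finset.univ.filter
        (fun e : Fin k → Fin n => Function.Injective e ∧ ∀ j, e j ∈ S j),
      sigmaTensor c e


/-! ### Product operators -/

lemma prodState_mul {n : ℕ} {α : Type*} [Fintype α] [DecidableEq α]
    (σ τ : Fin n → Matrix α α ℂ) :
    prodState σ * prodState τ = prodState (fun u => σ u * τ u) := by
  ext x y
  simp only [Matrix.mul_apply, prodState, ← Finset.prod_mul_distrib]
  rw [Finset.prod_univ_sum]
  simp

lemma prodState_conjTranspose {n : ℕ} {α : Type*} [Fintype α]
    (σ : Fin n → Matrix α α ℂ) :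
    (prodState σ).conjTranspose = prodState (fun u => (σ u).conjTranspose) := by
  ext x y
  simp [Matrix.conjTranspose_apply, prodState]

lemma prodState_diagonal {n : ℕ} {α : Type*} [Fintype α] [DecidableEq α]
    (d : Fin n → α → ℂ) :
    prodState (fun u => Matrix.diagonal (d u)) =
      Matrix.diagonal (fun x : Fin n → α => ∏ u, d u (x u)) := by
  ext x y
  simp only [prodState, Matrix.diagonal_apply]
  by_cases hxy : x = y
  · subst hxy; simp
  · rw [if_neg hxy]
    obtain ⟨u, hu⟩ := Function.ne_iff.mp hxy
    exact Finset.prod_eq_zero (Finset.mem_univ u) (by simp [hu])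

lemma prodState_one {n : ℕ} {α : Type*} [Fintype α] [DecidableEq α] :
    prodState (fun _ : Fin n => (1 : Matrix α α ℂ)) = 1 := by
  simp only [← Matrix.diagonal_one]
  rw [prodState_diagonal]
  simp

lemma pauli_mul_self (i : Fin 4) : pauli i * pauli i = 1 := by
  fin_cases i <;> ext a b <;> fin_cases a <;> fin_cases b <;>
    simp [pauli, Matrix.mul_apply, Fin.sum_univ_two]

lemma pauli_herm (i : Fin 4) : (pauli i).conjTranspose = pauli i := by
  fin_cases i <;> ext a b <;> fin_cases a <;> fin_cases b <;>
    simp [pauli, Matrix.conjTranspose_apply]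

lemma pauli_entry (i : Fin 4) (a b : Fin 2) : ‖pauli i a b‖ ≤ 1 := by
  fin_cases i <;> fin_cases a <;> fin_cases b <;> simp [pauli]

lemma pauli_complete (a b x y : Fin 2) :
    ∑ i, pauli i b a * pauli i x y = if a = x ∧ b = y then 2 else 0 := by
  fin_cases a <;> fin_cases b <;> fin_cases x <;> fin_cases y <;>
    simp [pauli, Fin.sum_univ_four] <;> norm_num

/-- A Pauli string. -/
def pstr {d' : ℕ} (q : Fin d' → Fin 4) : Matrix (Fin d' → Fin 2) (Fin d' → Fin 2) ℂ :=
  prodState (fun t => pauli (q t))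

lemma pstr_mul_self {d' : ℕ} (q : Fin d' → Fin 4) : pstr q * pstr q = 1 := by
  simp only [pstr, prodState_mul, pauli_mul_self, prodState_one]

lemma pstr_herm {d' : ℕ} (q : Fin d' → Fin 4) : (pstr q).IsHermitian := by
  simp only [Matrix.IsHermitian, pstr, prodState_conjTranspose, pauli_herm]

lemma pstr_diag {d' : ℕ} (q : Fin d' → Fin 4) :
    ∃ (U : Matrix (Fin d' → Fin 2) (Fin d' → Fin 2) ℂ) (l : (Fin d' → Fin 2) → ℝ),
      U * U.conjTranspose = 1 ∧ U.conjTranspose * U = 1 ∧ (∀ a, l a = 1 ∨ l a = -1) ∧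
      pstr q = U * Matrix.diagonal (fun a => (l a : ℂ)) * U.conjTranspose := by
  have hA := pstr_herm q
  set U : Matrix (Fin d' → Fin 2) (Fin d' → Fin 2) ℂ :=
    hA.eigenvectorUnitary.1 with hU
  have h1 : U * U.conjTranspose = 1 := Matrix.mem_unitaryGroup_iff.mp hA.eigenvectorUnitary.2
  have h2 : U.conjTranspose * U = 1 := Matrix.mem_unitaryGroup_iff'.mp hA.eigenvectorUnitary.2
  have h3 : pstr q = U * Matrix.diagonal (fun a => (hA.eigenvalues a : ℂ)) * U.conjTranspose := by
    have := hA.spectral_theorem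
    simpa [Unitary.conjStarAlgAut_apply, Matrix.star_eq_conjTranspose, Function.comp_def] using this
  refine ⟨U, hA.eigenvalues, h1, h2, ?_, h3⟩
  have h4 : Matrix.diagonal (fun a => (hA.eigenvalues a : ℂ)) = U.conjTranspose * pstr q * U := by
    calc _ = (U.conjTranspose * U) * Matrix.diagonal (fun a => (hA.eigenvalues a : ℂ)) *
        (U.conjTranspose * U) := by rw [h2]; simp
      _ = U.conjTranspose * (U * Matrix.diagonal (fun a => (hA.eigenvalues a : ℂ)) *
        U.conjTranspose) * U := by simp only [Matrix.mul_assoc]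
      _ = _ := by rw [← h3]
  have h5 : Matrix.diagonal (fun a => (hA.eigenvalues a : ℂ)) *
      Matrix.diagonal (fun a => (hA.eigenvalues a : ℂ)) = 1 := by
    rw [h4]
    calc _ = U.conjTranspose * pstr q * (U * U.conjTranspose) * pstr q * U := by
          simp only [Matrix.mul_assoc]
      _ = U.conjTranspose * (pstr q * pstr q) * U := by rw [h1]; simp [Matrix.mul_assoc]
      _ = 1 := by rw [pstr_mul_self]; simp [h2]
  intro a
  have h6 := congrFun (congrFun h5 a) a
  simp only [Matrix.diagonal_mul_diagonal, Matrix.diagonal_apply_eq, Matrix.one_apply_eq] at h6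
  have h7 : hA.eigenvalues a * hA.eigenvalues a = 1 := by exact_mod_cast h6
  exact mul_self_eq_one_iff.mp h7

/-! ### The operator norm -/

section norm
open scoped Matrix.Norms.L2Operator

variable {ι : Type*} [Fintype ι] [DecidableEq ι]

lemma opNorm_eq (A : Matrix ι ι ℂ) : opNorm A = ‖A‖ := rfl

lemma opNorm_sum_le {κ : Type*} (s : Finset κ) (A : κ → Matrix ι ι ℂ) :
    opNorm (∑ i ∈ s, A i) ≤ ∑ i ∈ s, opNorm (A i) := by
  simp only [opNorm_eq]
  exact norm_sum_le _ _

lemma opNorm_smul (c : ℂ) (A : Matrix ι ι ℂ) : opNorm (c • A) = ‖c‖ * opNorm A := by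
  simp only [opNorm_eq]
  exact norm_smul _ _

lemma opNorm_conj_diag (V : Matrix ι ι ℂ) (hV : V.conjTranspose * V = 1) (f : ι → ℂ) (B : ℝ)
    (hB : 0 ≤ B) (hf : ∀ i, ‖f i‖ ≤ B) :
    opNorm (V * Matrix.diagonal f * V.conjTranspose) ≤ B := by
  simp only [opNorm_eq]
  have h1 : ‖V‖ ≤ 1 := by
    have h := Matrix.l2_opNorm_conjTranspose_mul_self V
    have h' : ‖(1 : Matrix ι ι ℂ)‖ ≤ 1 := by
      rw [← Matrix.diagonal_one, Matrix.l2_opNorm_diagonal]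
      exact (pi_norm_le_iff_of_nonneg zero_le_one).2 (by simp)
    rw [hV] at h
    nlinarith [norm_nonneg V]
  have h2 : ‖V.conjTranspose‖ ≤ 1 := by rw [Matrix.l2_opNorm_conjTranspose]; exact h1
  have h3 : ‖Matrix.diagonal f‖ ≤ B := by
    rw [Matrix.l2_opNorm_diagonal]
    exact (pi_norm_le_iff_of_nonneg hB).2 hf
  calc _ ≤ ‖V * Matrix.diagonal f‖ * ‖V.conjTranspose‖ := Matrix.l2_opNorm_mul _ _
    _ ≤ (‖V‖ * ‖Matrix.diagonal f‖) * ‖V.conjTranspose‖ := by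
        gcongr; exact Matrix.l2_opNorm_mul _ _
    _ ≤ (1 * B) * 1 := by gcongr
    _ = B := by ring

lemma entry_le_opNorm (A : Matrix ι ι ℂ) (i j : ι) : ‖A i j‖ ≤ opNorm A := by
  have h := (Matrix.toEuclideanCLM (𝕜 := ℂ) A).le_opNorm (EuclideanSpace.single j 1)
  have h2 := PiLp.norm_apply_le
    ((Matrix.toEuclideanCLM (𝕜 := ℂ) A) (EuclideanSpace.single j 1)) i
  simp at h h2
  exact h2.trans h

end norm

/-! ### Greedy cut decomposition -/

/-- The tuples with `t j ∈ S j` for all `j`. -/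
def box {n k : ℕ} (S : Fin k → Finset (Fin n)) : Finset (Fin k → Fin n) :=
  Finset.univ.filter (fun t => ∀ j, t j ∈ S j)

lemma card_box_le {n k : ℕ} (S : Fin k → Finset (Fin n)) : (box S).card ≤ n ^ k := by
  refine (Finset.card_le_univ _).trans ?_
  simp

lemma greedy_aux {n k : ℕ} (J : (Fin k → Fin n) → ℝ) (δ Q : ℝ) (hδ : 0 < δ) (hQ : 0 < Q)
    (hJ : ∑ t, J t ^ 2 ≤ Q) (N : ℕ) :
    (∃ (M : ℕ) (w : Fin M → ℝ) (S : Fin M → Fin k → Finset (Fin n)), M < N ∧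
      ∀ T : Fin k → Finset (Fin n),
        |∑ t ∈ box T, (J t - ∑ i, if t ∈ box (S i) then w i else 0)| ≤
          δ * Real.sqrt ((n : ℝ) ^ k * Q)) ∨
    (∃ (w : Fin N → ℝ) (S : Fin N → Fin k → Finset (Fin n)),
      ∑ t, (J t - ∑ i, if t ∈ box (S i) then w i else 0) ^ 2 ≤ Q - N * (δ ^ 2 * Q)) := by
  induction N with
  | zero =>
    right
    exact ⟨fun _ => 0, fun _ _ => ∅, by simpa using hJ⟩
  | succ N ih =>
    rcases ih with ⟨M, w, S, hM, h⟩ | ⟨w, S, h⟩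
    · exact Or.inl ⟨M, w, S, by omega, h⟩
    · by_cases hg : ∀ T : Fin k → Finset (Fin n),
        |∑ t ∈ box T, (J t - ∑ i, if t ∈ box (S i) then w i else 0)| ≤
          δ * Real.sqrt ((n : ℝ) ^ k * Q)
      · exact Or.inl ⟨N, w, S, by omega, hg⟩
      · right
        push Not at hg
        obtain ⟨T, hT⟩ := hg
        set R : (Fin k → Fin n) → ℝ :=
          fun t => J t - ∑ i, if t ∈ box (S i) then w i else 0 with hR
        set a := ∑ t ∈ box T, R t with ha
        set s : ℝ := ((box T).card : ℝ) with hs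
        have ha' : δ * Real.sqrt ((n : ℝ) ^ k * Q) < |a| := hT
        have hsk : s ≤ (n : ℝ) ^ k := by
          rw [hs]; exact_mod_cast card_box_le T
        have hs0 : 0 < s := by
          rw [hs]
          by_contra hc
          have hc0 : box T = ∅ := by simpa using hc
          have : a = 0 := by rw [ha, hc0]; simp
          rw [this, abs_zero] at ha'
          have : 0 ≤ δ * Real.sqrt ((n : ℝ) ^ k * Q) := by positivity
          linarith
        have ha2 : δ ^ 2 * ((n : ℝ) ^ k * Q) ≤ a ^ 2 := by
          have h0 : 0 ≤ δ * Real.sqrt ((n : ℝ) ^ k * Q) := by positivity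
          have := pow_le_pow_left₀ h0 ha'.le 2
          rw [mul_pow, Real.sq_sqrt (by positivity), sq_abs] at this
          exact this
        have hdec : δ ^ 2 * Q ≤ a ^ 2 / s := by
          rw [le_div_iff₀ hs0]
          have : δ ^ 2 * Q * s ≤ δ ^ 2 * Q * (n : ℝ) ^ k := by gcongr
          nlinarith
        refine ⟨Fin.cons (a / s) w, Fin.cons T S, ?_⟩
        have key : ∑ t, (J t - ∑ i : Fin (N + 1), if t ∈ box ((Fin.cons T S :
              Fin (N + 1) → Fin k → Finset (Fin n)) i) then
              (Fin.cons (a / s) w : Fin (N + 1) → ℝ) i else 0) ^ 2 =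
            ∑ t, R t ^ 2 - a ^ 2 / s := by
          have e1 : ∀ t, (J t - ∑ i : Fin (N + 1), if t ∈ box ((Fin.cons T S :
              Fin (N + 1) → Fin k → Finset (Fin n)) i) then
              (Fin.cons (a / s) w : Fin (N + 1) → ℝ) i else 0) ^ 2 =
              R t ^ 2 + (if t ∈ box T then (-2 * (a / s) * R t + (a / s) ^ 2) else 0) := by
            intro t
            rw [Fin.sum_univ_succ]
            simp only [Fin.cons_zero, Fin.cons_succ, hR]
            split_ifs <;> ring
          simp only [e1]
          rw [Finset.sum_add_distrib, Finset.sum_ite_mem, Finset.univ_inter,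
            Finset.sum_add_distrib, ← Finset.mul_sum, ← ha, Finset.sum_const, nsmul_eq_mul, ← hs]
          field_simp
          ring
        rw [key]
        push_cast
        linarith

lemma greedy {n k : ℕ} (J : (Fin k → Fin n) → ℝ) (δ Q : ℝ) (hδ : 0 < δ) (hQ : 0 < Q)
    (hJ : ∑ t, J t ^ 2 ≤ Q) :
    ∃ (M : ℕ) (w : Fin M → ℝ) (S : Fin M → Fin k → Finset (Fin n)), (M : ℝ) ≤ 1 / δ ^ 2 ∧
      ∀ T : Fin k → Finset (Fin n),
        |∑ t ∈ box T, (J t - ∑ i, if t ∈ box (S i) then w i else 0)| ≤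
          δ * Real.sqrt ((n : ℝ) ^ k * Q) := by
  rcases greedy_aux J δ Q hδ hQ hJ (⌊1 / δ ^ 2⌋₊ + 1) with ⟨M, w, S, hM, h⟩ | ⟨w, S, h⟩
  · refine ⟨M, w, S, ?_, h⟩
    have h1 : (M : ℝ) ≤ (⌊1 / δ ^ 2⌋₊ : ℝ) := by exact_mod_cast Nat.lt_succ_iff.mp hM
    exact h1.trans (Nat.floor_le (by positivity))
  · exfalso
    have h0 : 0 ≤ ∑ t, (J t - ∑ i, if t ∈ box (S i) then w i else 0) ^ 2 :=
      Finset.sum_nonneg (fun _ _ => sq_nonneg _)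
    have h1 := Nat.lt_floor_add_one (1 / δ ^ 2)
    rw [div_lt_iff₀ (by positivity)] at h1
    push_cast at h
    nlinarith

/-! ### From cuts to the operator norm -/

lemma sign_bound {n k : ℕ} (R : (Fin k → Fin n) → ℝ) (B : ℝ)
    (hB : ∀ T : Fin k → Finset (Fin n), |∑ t ∈ box T, R t| ≤ B)
    (p : Fin n → Fin k) (s : Fin k → Fin n → ℝ) (hs : ∀ j u, s j u = 1 ∨ s j u = -1) :
    |∑ t ∈ Finset.univ.filter (fun t : Fin k → Fin n => ∀ j, p (t j) = j),
      R t * ∏ j, s j (t j)| ≤ 2 ^ k * B := by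
  classical
  let sg : Bool → ℝ := fun b => if b then 1 else -1
  let T : (Fin k → Bool) → Fin k → Finset (Fin n) :=
    fun β j => Finset.univ.filter (fun u => p u = j ∧ s j u = sg (β j))
  have e1 : ∀ t : Fin k → Fin n, ∏ j, s j (t j) =
      ∑ β : Fin k → Bool, (∏ j, sg (β j)) * (if ∀ j, s j (t j) = sg (β j) then 1 else 0) := by
    intro t
    have : ∀ j, s j (t j) = ∑ b : Bool, sg b * (if s j (t j) = sg b then 1 else 0) := by
      intro j
      rcases hs j (t j) with h | h <;> simp [h, sg] <;> norm_num
    rw [Finset.prod_congr rfl (fun j _ => this j), Finset.prod_univ_sum]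
    simp only [Fintype.piFinset_univ, Finset.prod_mul_distrib]
    refine Finset.sum_congr rfl (fun β _ => ?_)
    congr 1
    rw [Finset.prod_ite_zero]
    simp
  have e2 : ∑ t ∈ Finset.univ.filter (fun t : Fin k → Fin n => ∀ j, p (t j) = j),
      R t * ∏ j, s j (t j) = ∑ β : Fin k → Bool, (∏ j, sg (β j)) * ∑ t ∈ box (T β), R t := by
    simp only [e1, Finset.mul_sum]
    rw [Finset.sum_comm]
    refine Finset.sum_congr rfl (fun β _ => ?_)
    simp only [box, Finset.sum_filter]
    refine Finset.sum_congr rfl (fun t _ => ?_)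
    have : (∀ j, t j ∈ T β j) ↔ (∀ j, p (t j) = j) ∧ ∀ j, s j (t j) = sg (β j) := by
      simp [T, forall_and]
    simp only [this]
    by_cases h1 : ∀ j, p (t j) = j <;> by_cases h2 : ∀ j, s j (t j) = sg (β j) <;>
      simp [h1, h2, mul_comm]
  rw [e2]
  refine (Finset.abs_sum_le_sum_abs _ _).trans ?_
  calc _ ≤ ∑ β : Fin k → Bool, B := by
        refine Finset.sum_le_sum (fun β _ => ?_)
        rw [abs_mul, Finset.abs_prod]
        have : ∏ j, |sg (β j)| = 1 :=
          Finset.prod_eq_one (fun j _ => by simp only [sg]; split_ifs <;> simp)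
        rw [this, one_mul]
        exact hB _
    _ = 2 ^ k * B := by simp

lemma sigmaTensor_eq {n k d' : ℕ} (c : Fin k → Fin d' → Fin 4) (t : Fin k → Fin n)
    (p : Fin n → Fin k) (hp : ∀ j, p (t j) = j) :
    sigmaTensor c t = prodState (fun u => if ∃ j, t j = u then pstr (c (p u)) else 1) := by
  classical
  have ht : Function.Injective t := fun a b h => by rw [← hp a, ← hp b, h]
  ext x y
  simp only [sigmaTensor, prodState]
  have e1 : ∀ u, (if ∃ j, t j = u then pstr (c (p u)) else 1) (x u) (y u) =
      (if u ∈ Finset.univ.image t then pstr (c (p u)) (x u) (y u) else 1) *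
      (if ∃ j, t j = u then (1 : ℂ) else if x u = y u then 1 else 0) := by
    intro u
    by_cases h : ∃ j, t j = u
    · simp [h]
    · simp [h, Matrix.one_apply]
  rw [Finset.prod_congr rfl (fun u _ => e1 u), Finset.prod_mul_distrib]
  congr 1
  rw [Finset.prod_ite_mem, Finset.univ_inter, Finset.prod_image (fun a _ b _ h => ht h)]
  simp [hp, pstr, prodState]

lemma part_bound {n k d' : ℕ} (c : Fin k → Fin d' → Fin 4) (R : (Fin k → Fin n) → ℝ) (B : ℝ)
    (hB : ∀ T : Fin k → Finset (Fin n), |∑ t ∈ box T, R t| ≤ B) (p : Fin n → Fin k) :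
    opNorm (∑ t ∈ Finset.univ.filter (fun t : Fin k → Fin n => ∀ j, p (t j) = j),
      (R t : ℂ) • sigmaTensor c t) ≤ 2 ^ k * B := by
  classical
  choose U l hU1 hU2 hl hP using (pstr_diag (d' := d'))
  have hB0 : 0 ≤ B := (abs_nonneg _).trans (hB (fun _ => ∅))
  set V := prodState (fun u : Fin n => U (c (p u))) with hV
  have hVV : V.conjTranspose * V = 1 := by
    rw [hV, prodState_conjTranspose, prodState_mul]
    simp only [hU2, prodState_one]
  have hσ : ∀ t : Fin k → Fin n, (∀ j, p (t j) = j) → sigmaTensor c t =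
      V * Matrix.diagonal (fun x : Fin n → Fin d' → Fin 2 =>
        ((∏ j, l (c j) (x (t j)) : ℝ) : ℂ)) * V.conjTranspose := by
    intro t ht
    have hti : Function.Injective t := fun a b h => by rw [← ht a, ← ht b, h]
    have e1 : Matrix.diagonal (fun x : Fin n → Fin d' → Fin 2 =>
        ((∏ j, l (c j) (x (t j)) : ℝ) : ℂ)) = prodState (fun u => Matrix.diagonal
          (fun a => if ∃ j, t j = u then (l (c (p u)) a : ℂ) else 1)) := by
      rw [prodState_diagonal]
      congr 1
      ext x
      have : ∀ u, (if ∃ j, t j = u then (l (c (p u)) (x u) : ℂ) else 1) =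
          if u ∈ Finset.univ.image t then (l (c (p u)) (x u) : ℂ) else 1 := by
        intro u; simp
      rw [Finset.prod_congr rfl (fun u _ => this u), Finset.prod_ite_mem, Finset.univ_inter,
        Finset.prod_image (fun a _ b _ h => hti h)]
      simp [ht]
    rw [e1, hV, prodState_conjTranspose, prodState_mul, prodState_mul, sigmaTensor_eq c t p ht]
    congr 1
    ext1 u
    by_cases h : ∃ j, t j = u
    · simp only [h, if_true]; exact hP _
    · simp only [h, if_false, Matrix.diagonal_one, Matrix.mul_one]; exact (hU1 _).symm
  have e2 : (∑ t ∈ Finset.univ.filter (fun t : Fin k → Fin n => ∀ j, p (t j) = j),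
      (R t : ℂ) • sigmaTensor c t) = V * Matrix.diagonal (fun x : Fin n → Fin d' → Fin 2 =>
        ((∑ t ∈ Finset.univ.filter (fun t : Fin k → Fin n => ∀ j, p (t j) = j),
          R t * ∏ j, l (c j) (x (t j)) : ℝ) : ℂ)) * V.conjTranspose := by
    have e3 : Matrix.diagonal (fun x : Fin n → Fin d' → Fin 2 =>
        ((∑ t ∈ Finset.univ.filter (fun t : Fin k → Fin n => ∀ j, p (t j) = j),
          R t * ∏ j, l (c j) (x (t j)) : ℝ) : ℂ)) =
        ∑ t ∈ Finset.univ.filter (fun t : Fin k → Fin n => ∀ j, p (t j) = j),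
          (R t : ℂ) • Matrix.diagonal (fun x : Fin n → Fin d' → Fin 2 =>
            ((∏ j, l (c j) (x (t j)) : ℝ) : ℂ)) := by
      ext x y
      simp only [Matrix.sum_apply, Matrix.smul_apply, Matrix.diagonal_apply]
      by_cases h : x = y <;> simp [h]
    rw [e3, Finset.mul_sum, Finset.sum_mul]
    refine Finset.sum_congr rfl (fun t ht => ?_)
    rw [hσ t (by simpa using ht)]
    simp
  rw [e2]
  refine opNorm_conj_diag V hVV _ _ (by positivity) (fun x => ?_)
  rw [Complex.norm_real]
  exact sign_bound R B hB p (fun j u => l (c j) (x u)) (fun j u => hl _ _)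

lemma count_part {n k : ℕ} (t : Fin k → Fin n) (ht : Function.Injective t) :
    (Finset.univ.filter (fun p : Fin n → Fin k => ∀ j, p (t j) = j)).card * k ^ k = k ^ n := by
  classical
  have e : Finset.univ.filter (fun p : Fin n → Fin k => ∀ j, p (t j) = j) =
      Fintype.piFinset (fun u => Finset.univ.filter (fun i => ∀ j, t j = u → i = j)) := by
    ext p
    simp only [Finset.mem_filter, Finset.mem_univ, true_and, Fintype.mem_piFinset]
    exact ⟨fun h u j hj => by rw [← hj]; exact h j, fun h j => h _ j rfl⟩
  have hc : ∀ u, (Finset.univ.filter (fun i : Fin k => ∀ j, t j = u → i = j)).card =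
      if u ∈ Finset.univ.image t then 1 else k := by
    intro u
    split_ifs with h
    · obtain ⟨j, -, rfl⟩ := Finset.mem_image.mp h
      rw [Finset.card_eq_one]
      refine ⟨j, ?_⟩
      ext i
      simp only [Finset.mem_filter, Finset.mem_univ, true_and, Finset.mem_singleton]
      exact ⟨fun h => h j rfl, fun h j' hj' => by rw [h, ht hj']⟩
    · rw [Finset.filter_true_of_mem]
      · simp
      · intro i _ j hj
        exact absurd (Finset.mem_image.mpr ⟨j, Finset.mem_univ _, hj⟩) h
  rw [e, Fintype.card_piFinset, Finset.prod_congr rfl (fun u _ => hc u)]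
  have e2 : k ^ k = ∏ u : Fin n, if u ∈ Finset.univ.image t then k else 1 := by
    rw [Finset.prod_ite_mem, Finset.univ_inter, Finset.prod_const,
      Finset.card_image_of_injective _ ht]
    simp
  conv_lhs => rw [e2]
  rw [← Finset.prod_mul_distrib]
  calc _ = ∏ u : Fin n, k := Finset.prod_congr rfl (fun u _ => by split_ifs <;> simp)
    _ = k ^ n := by simp

lemma cut_bound {n k d' : ℕ} (hk : 0 < k) (c : Fin k → Fin d' → Fin 4)
    (R : (Fin k → Fin n) → ℝ) (B : ℝ)
    (hB : ∀ T : Fin k → Finset (Fin n), |∑ t ∈ box T, R t| ≤ B) :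
    opNorm (∑ t ∈ Finset.univ.filter (fun t : Fin k → Fin n => Function.Injective t),
      (R t : ℂ) • sigmaTensor c t) ≤ k ^ k * (2 ^ k * B) := by
  classical
  set X := ∑ t ∈ Finset.univ.filter (fun t : Fin k → Fin n => Function.Injective t),
      (R t : ℂ) • sigmaTensor c t with hX
  have e : ((k : ℂ) ^ n) • X = ((k : ℂ) ^ k) • ∑ p : Fin n → Fin k,
      ∑ t ∈ Finset.univ.filter (fun t : Fin k → Fin n => ∀ j, p (t j) = j),
      (R t : ℂ) • sigmaTensor c t := by
    simp only [Finset.sum_filter]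
    rw [Finset.sum_comm, hX, Finset.sum_filter, Finset.smul_sum, Finset.smul_sum]
    refine Finset.sum_congr rfl (fun t _ => ?_)
    rw [← Finset.sum_filter, Finset.sum_const, ← Nat.cast_smul_eq_nsmul ℂ, smul_smul]
    split_ifs with ht
    · rw [← Nat.cast_pow, ← Nat.cast_pow, ← Nat.cast_mul, ← count_part t ht, mul_comm]
    · rw [Finset.filter_false_of_mem]
      · simp
      · intro p _ hp
        exact ht (fun a b h => by rw [← hp a, ← hp b, h])
  have h1 := congrArg opNorm e
  rw [opNorm_smul, opNorm_smul] at h1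
  simp only [norm_pow, Complex.norm_natCast] at h1
  have hkn : (0 : ℝ) < (k : ℝ) ^ n := by positivity
  have h2 : (k : ℝ) ^ n * opNorm X ≤ (k : ℝ) ^ n * (k ^ k * (2 ^ k * B)) := by
    rw [h1]
    calc _ ≤ (k : ℝ) ^ k * ∑ p : Fin n → Fin k, 2 ^ k * B := by
          gcongr
          exact (opNorm_sum_le _ _).trans (Finset.sum_le_sum (fun p _ => part_bound c R B hB p))
      _ = _ := by simp; ring
  exact le_of_mul_le_mul_left h2 hkn

/-! ### Pauli decomposition -/

lemma pauli_complete_multi {k d' : ℕ} (a b x y : Fin k → Fin d' → Fin 2) :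
    ∑ c : Fin k → Fin d' → Fin 4, (∏ j, ∏ s, pauli (c j s) (b j s) (a j s)) *
      (∏ j, ∏ s, pauli (c j s) (x j s) (y j s)) =
      if a = x ∧ b = y then ((2 : ℂ) ^ d') ^ k else 0 := by
  have e1 : ∑ c : Fin k → Fin d' → Fin 4, (∏ j, ∏ s, pauli (c j s) (b j s) (a j s)) *
      (∏ j, ∏ s, pauli (c j s) (x j s) (y j s)) =
      ∏ j, ∏ s, ∑ i, pauli i (b j s) (a j s) * pauli i (x j s) (y j s) := by
    simp only [Finset.prod_univ_sum, Fintype.piFinset_univ, Finset.prod_mul_distrib]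
  rw [e1]
  simp only [pauli_complete]
  split_ifs with h
  · obtain ⟨rfl, rfl⟩ := h
    simp
  · have : ∃ j s, ¬ (a j s = x j s ∧ b j s = y j s) := by
      by_contra hc
      push Not at hc
      exact h ⟨by ext1 j; ext1 s; exact (hc j s).1, by ext1 j; ext1 s; exact (hc j s).2⟩
    obtain ⟨j, s, hjs⟩ := this
    exact Finset.prod_eq_zero (Finset.mem_univ j)
      (Finset.prod_eq_zero (Finset.mem_univ s) (if_neg hjs))

/-- A crude bound on Pauli coefficients. -/
def Lc (k d' : ℕ) : ℝ :=
  (Fintype.card (Fin k → Fin d' → Fin 2) : ℝ) * (Fintype.card (Fin k → Fin d' → Fin 2) : ℝ)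

lemma pauli_decomp {n k d' : ℕ} (t : Fin k → Fin n) (ht : Function.Injective t)
    (A : Matrix (Fin n → Fin d' → Fin 2) (Fin n → Fin d' → Fin 2) ℂ)
    (hA : A.IsHermitian) (hact : ActsOn A (Finset.univ.image t)) (hn : opNorm A ≤ 1) :
    ∃ J : (Fin k → Fin d' → Fin 4) → ℝ, (∀ c, |J c| ≤ Lc k d') ∧
      A = ∑ c, (J c : ℂ) • sigmaTensor c t := by
  classical
  let ext (a : Fin k → Fin d' → Fin 2) : Fin n → Fin d' → Fin 2 := Function.extend t a 0
  have hext : ∀ a j, ext a (t j) = a j := fun a j => ht.extend_apply a 0 j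
  have hext' : ∀ a u, u ∉ Finset.univ.image t → ext a u = 0 := fun a u hu =>
    Function.extend_apply' _ _ _ (by simpa using hu)
  let M' : (Fin k → Fin d' → Fin 2) → (Fin k → Fin d' → Fin 2) → ℂ := fun a b => A (ext a) (ext b)
  have hM1 : ∀ a b, ‖M' a b‖ ≤ 1 := fun a b => (entry_le_opNorm A _ _).trans hn
  have hMh : ∀ a b, star (M' a b) = M' b a := fun a b => hA.apply _ _
  have hAM : ∀ x y, A x y = (if ∀ u ∉ Finset.univ.image t, x u = y u then (1 : ℂ) else 0) *
      M' (fun j => x (t j)) (fun j => y (t j)) := by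
    intro x y
    obtain ⟨M, hM⟩ := hact
    have hr : ∀ z : Fin n → Fin d' → Fin 2,
        (fun u : {u // u ∈ Finset.univ.image t} => ext (fun j => z (t j)) u.1) =
        fun u => z u.1 := by
      intro z
      ext1 u
      obtain ⟨u, hu⟩ := u
      obtain ⟨j, -, rfl⟩ := Finset.mem_image.mp hu
      exact hext _ j
    have : M' (fun j => x (t j)) (fun j => y (t j)) =
        M (fun u => x u.1) (fun u => y u.1) := by
      simp only [M']
      rw [hM, hr, hr, if_pos, one_mul]
      intro u hu
      rw [hext' _ u hu, hext' _ u hu]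
    rw [this, hM]
  let z : (Fin k → Fin d' → Fin 4) → ℂ := fun c => (((2 : ℂ) ^ d') ^ k)⁻¹ *
    ∑ a, ∑ b, M' a b * ∏ j, ∏ s, pauli (c j s) (b j s) (a j s)
  have hp : ∀ (i : Fin 4) (a b : Fin 2), star (pauli i a b) = pauli i b a := by
    intro i a b
    have := congrFun (congrFun (pauli_herm i) b) a
    simpa [Matrix.conjTranspose_apply] using this
  have hzr : ∀ c, ((z c).re : ℂ) = z c := by
    intro c
    apply Complex.conj_eq_iff_re.mp
    change star (z c) = z c
    simp only [z, star_mul', star_sum, star_prod, hMh, hp]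
    rw [Finset.sum_comm]
    congr 1
    simp
  have hzb : ∀ c, ‖z c‖ ≤ Lc k d' := by
    intro c
    simp only [z]
    rw [norm_mul]
    have h1 : ‖(((2 : ℂ) ^ d') ^ k)⁻¹‖ ≤ 1 := by
      rw [norm_inv]
      apply inv_le_one_of_one_le₀
      simp only [norm_pow, Complex.norm_ofNat]
      exact one_le_pow₀ (one_le_pow₀ (by norm_num))
    have h2 : ‖∑ a, ∑ b, M' a b * ∏ j, ∏ s, pauli (c j s) (b j s) (a j s)‖ ≤ Lc k d' := by
      calc _ ≤ ∑ a : Fin k → Fin d' → Fin 2, ∑ b : Fin k → Fin d' → Fin 2, (1 : ℝ) := by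
            refine norm_sum_le_of_le _ (fun a _ => norm_sum_le_of_le _ (fun b _ => ?_))
            rw [norm_mul, norm_prod]
            refine mul_le_one₀ (hM1 a b) (by positivity) ?_
            refine Finset.prod_le_one (fun _ _ => norm_nonneg _) (fun j _ => ?_)
            rw [norm_prod]
            exact Finset.prod_le_one (fun _ _ => norm_nonneg _) (fun s _ => pauli_entry _ _ _)
        _ = Lc k d' := by simp [Lc]
    calc _ ≤ 1 * Lc k d' := by gcongr
      _ = _ := one_mul _
  refine ⟨fun c => (z c).re, fun c => (Complex.abs_re_le_norm _).trans (hzb c), ?_⟩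
  simp only [hzr]
  ext x y
  have hδ : (∏ w : Fin n, if ∃ j, t j = w then (1 : ℂ) else if x w = y w then 1 else 0) =
      if ∀ u ∉ Finset.univ.image t, x u = y u then (1 : ℂ) else 0 := by
    have : ∀ w, (if ∃ j, t j = w then (1 : ℂ) else if x w = y w then 1 else 0) =
        if (w ∉ Finset.univ.image t → x w = y w) then 1 else 0 := by
      intro w
      by_cases h : ∃ j, t j = w
      · simp [h]
      · simp [h]
    rw [Finset.prod_congr rfl (fun w _ => this w), Finset.prod_ite_zero]
    simp
  rw [hAM x y, Matrix.sum_apply]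
  simp only [Matrix.smul_apply, sigmaTensor, hδ, smul_eq_mul]
  simp only [← mul_assoc]
  rw [← Finset.sum_mul, mul_comm]
  congr 1
  have h2 : ((2 : ℂ) ^ d') ^ k ≠ 0 := by positivity
  simp only [z, mul_assoc, ← Finset.mul_sum]
  rw [eq_inv_mul_iff_mul_eq₀ h2]
  simp only [Finset.sum_mul]
  rw [Finset.sum_comm]
  have e3 : ∀ a b, ∑ c : Fin k → Fin d' → Fin 4,
      M' a b * (∏ j, ∏ s, pauli (c j s) (b j s) (a j s)) *
        (∏ j, ∏ s, pauli (c j s) (x (t j) s) (y (t j) s)) =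
      if a = (fun j => x (t j)) ∧ b = (fun j => y (t j)) then
        M' a b * ((2 : ℂ) ^ d') ^ k else 0 := by
    intro a b
    simp only [mul_assoc]
    rw [← Finset.mul_sum,
      pauli_complete_multi a b (fun j => x (t j)) (fun j => y (t j))]
    simp
  have e4 : ∀ a, ∑ c : Fin k → Fin d' → Fin 4, ∑ b,
      M' a b * (∏ j, ∏ s, pauli (c j s) (b j s) (a j s)) *
        (∏ j, ∏ s, pauli (c j s) (x (t j) s) (y (t j) s)) =
      if a = (fun j => x (t j)) then
        M' a (fun j => y (t j)) * ((2 : ℂ) ^ d') ^ k else 0 := by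
    intro a
    rw [Finset.sum_comm]
    simp only [e3]
    by_cases h : a = (fun j => x (t j)) <;> simp [h]
  rw [Finset.sum_congr rfl (fun a _ => e4 a)]
  simp [mul_comm]

/-- For fixed `k` and `d = 2^{d'}` there is a constant `C` such that for
every `ε ∈ (0,1)`, every `n ≥ C·ε^{−3}`, and every `k`-local Hamiltonian `H` on `n` qudits of
local dimension `d` with `m` interactions of operator norm at most 1, there is a Hamiltonian
`H_D` which is a sum of at most `C·ε^{−2}` complete bipartite sub-Hamiltonians such that
`‖H − H_D‖_∞ ≤ ε·n^{k/2}·√m`. -/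
theorem klocal_cut_decomposition_spectral :
    ∀ k d' : ℕ, 0 < k → ∃ C : ℝ, 0 < C ∧
      ∀ (ε : ℝ), 0 < ε → ε < 1 →
      ∀ (n : ℕ), C / ε ^ 3 ≤ (n : ℝ) →
      ∀ (E : Finset (Finset (Fin n)))
        (h : Finset (Fin n) →
          Matrix (Fin n → Fin d' → Fin 2) (Fin n → Fin d' → Fin 2) ℂ),
        (∀ e ∈ E, e.card = k) →
        (∀ e ∈ E, (h e).IsHermitian) →
        (∀ e ∈ E, ActsOn (h e) e) →
        (∀ e ∈ E, opNorm (h e) ≤ 1) →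
        ∃ (N : ℕ) (col : Fin N → Fin k → Fin d' → Fin 4) (w : Fin N → ℝ)
          (S : Fin N → Fin k → Finset (Fin n)),
          (N : ℝ) ≤ C / ε ^ 2 ∧
          opNorm ((∑ e ∈ E, h e) - ∑ i, cbsH (col i) (w i) (S i)) ≤
            ε * (n : ℝ) ^ ((k : ℝ) / 2) * Real.sqrt (E.card) := by
  classical
  intro k d' hk
  set K : ℝ := (Fintype.card (Fin k → Fin d' → Fin 4) : ℝ) with hK
  have hK0 : 0 < K := by rw [hK]; exact_mod_cast Fintype.card_pos
  have hL0 : 0 < Lc k d' := by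
    have : 0 < (Fintype.card (Fin k → Fin d' → Fin 2) : ℝ) := by
      exact_mod_cast Fintype.card_pos
    unfold Lc; positivity
  set G : ℝ := K * ((k : ℝ) ^ k * 2 ^ k) * Lc k d' with hG
  have hG0 : 0 < G := by positivity
  refine ⟨K * G ^ 2, by positivity, ?_⟩
  intro ε hε hε1 n _ E h hcard hherm hact hnorm
  rcases E.eq_empty_or_nonempty with rfl | hE
  · refine ⟨0, fun _ _ _ => 0, fun _ => 0, fun _ _ => ∅, by simp; positivity, ?_⟩
    simp [opNorm]
  have hm : 0 < (E.card : ℝ) := by exact_mod_cast Finset.card_pos.mpr hE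
  have hord : ∀ e : Finset (Fin n), ∃ t : Fin k → Fin n, e ∈ E →
      Function.Injective t ∧ Finset.univ.image t = e := by
    intro e
    by_cases he : e ∈ E
    · refine ⟨e.orderEmbOfFin (hcard e he), fun _ => ⟨(e.orderEmbOfFin _).injective, ?_⟩⟩
      exact Finset.image_orderEmbOfFin_univ _ _
    · obtain ⟨e', he'⟩ := hE
      have := hcard e' he'
      have h1 : e'.Nonempty := Finset.card_pos.mp (by omega)
      obtain ⟨v, _⟩ := h1
      exact ⟨fun _ => v, fun h => absurd h he⟩
  choose ord hord using hord
  have hinj : Set.InjOn ord (E : Set (Finset (Fin n))) := by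
    intro a ha b hb hab
    rw [← (hord a ha).2, ← (hord b hb).2, hab]
  have hdec : ∀ e : Finset (Fin n), ∃ J : (Fin k → Fin d' → Fin 4) → ℝ, e ∈ E →
      (∀ c, |J c| ≤ Lc k d') ∧ h e = ∑ c, (J c : ℂ) • sigmaTensor c (ord e) := by
    intro e
    by_cases he : e ∈ E
    · obtain ⟨J, hJ⟩ := pauli_decomp (ord e) (hord e he).1 (h e) (hherm e he)
        (by rw [(hord e he).2]; exact hact e he) (hnorm e he)
      exact ⟨J, fun _ => hJ⟩
    · exact ⟨fun _ => 0, fun h => absurd h he⟩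
  choose J0 hJ0 using hdec
  let J : (Fin k → Fin d' → Fin 4) → (Fin k → Fin n) → ℝ := fun c t =>
    if t ∈ E.image ord then J0 (Finset.univ.image t) c else 0
  have hH : ∑ e ∈ E, h e = ∑ c, ∑ t ∈ Finset.univ.filter
      (fun t : Fin k → Fin n => Function.Injective t), (J c t : ℂ) • sigmaTensor c t := by
    have e1 : ∀ c, ∑ t ∈ Finset.univ.filter
        (fun t : Fin k → Fin n => Function.Injective t), (J c t : ℂ) • sigmaTensor c t =
        ∑ e ∈ E, (J0 e c : ℂ) • sigmaTensor c (ord e) := by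
      intro c
      have e2 : ∑ e ∈ E, (J0 e c : ℂ) • sigmaTensor c (ord e) =
          ∑ t ∈ E.image ord, (J c t : ℂ) • sigmaTensor c t := by
        rw [Finset.sum_image hinj]
        refine Finset.sum_congr rfl (fun e he => ?_)
        simp only [J]
        rw [if_pos (Finset.mem_image_of_mem _ he), (hord e he).2]
      rw [e2]
      symm
      apply Finset.sum_subset
      · intro t ht
        obtain ⟨e, he, rfl⟩ := Finset.mem_image.mp ht
        simpa using (hord e he).1
      · intro t _ ht
        simp only [J]
        rw [if_neg ht]
        simp
    rw [Finset.sum_congr rfl (fun c _ => e1 c), Finset.sum_comm]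
    exact Finset.sum_congr rfl (fun e he => (hJ0 e he).2)
  have hJsq : ∀ c, ∑ t, J c t ^ 2 ≤ Lc k d' ^ 2 * E.card := by
    intro c
    have e1 : ∑ t, J c t ^ 2 = ∑ t ∈ E.image ord, J0 (Finset.univ.image t) c ^ 2 := by
      simp only [J, ite_pow]
      rw [← Finset.univ_inter (E.image ord), ← Finset.sum_ite_mem]
      simp
    rw [e1, Finset.sum_image hinj]
    calc _ ≤ ∑ e ∈ E, Lc k d' ^ 2 := by
          refine Finset.sum_le_sum (fun e he => ?_)
          rw [(hord e he).2, ← sq_abs]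
          exact pow_le_pow_left₀ (abs_nonneg _) ((hJ0 e he).1 c) 2
      _ = _ := by simp [mul_comm]
  set δ := ε / G with hδ
  have hδ0 : 0 < δ := by positivity
  choose M w S hM hcut using fun c => greedy (J c) δ (Lc k d' ^ 2 * E.card) hδ0
    (by positivity) (hJsq c)
  let I := Σ c : Fin k → Fin d' → Fin 4, Fin (M c)
  let φ : Fin (Fintype.card I) ≃ I := (Fintype.equivFin I).symm
  refine ⟨Fintype.card I, fun i => (φ i).1, fun i => w (φ i).1 (φ i).2,
    fun i => S (φ i).1 (φ i).2, ?_, ?_⟩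
  · have : (Fintype.card I : ℝ) = ∑ c, (M c : ℝ) := by simp [I]
    rw [this]
    calc _ ≤ ∑ c : Fin k → Fin d' → Fin 4, 1 / δ ^ 2 := Finset.sum_le_sum (fun c _ => hM c)
      _ = K * (1 / δ ^ 2) := by rw [Finset.sum_const, nsmul_eq_mul, Finset.card_univ]
      _ = _ := by rw [hδ]; field_simp
  · have e1 : ∑ i, cbsH (φ i).1 (w (φ i).1 (φ i).2) (S (φ i).1 (φ i).2) =
        ∑ c, ∑ i, cbsH c (w c i) (S c i) := by
      rw [Equiv.sum_comp φ (fun x : I => cbsH x.1 (w x.1 x.2) (S x.1 x.2)), Fintype.sum_sigma]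
    have e2 : ∀ c, ∑ i, cbsH c (w c i) (S c i) = ∑ t ∈ Finset.univ.filter
        (fun t : Fin k → Fin n => Function.Injective t),
        ((∑ i, if t ∈ box (S c i) then w c i else 0 : ℝ) : ℂ) • sigmaTensor c t := by
      intro c
      simp only [Complex.ofReal_sum, Finset.sum_smul]
      rw [Finset.sum_comm]
      refine Finset.sum_congr rfl (fun i _ => ?_)
      rw [cbsH, ← Finset.filter_filter, Finset.sum_filter, Finset.smul_sum]
      refine Finset.sum_congr rfl (fun t _ => ?_)
      by_cases hh : ∀ j, t j ∈ S c i j <;> simp [box, hh]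
    rw [e1, hH, ← Finset.sum_sub_distrib]
    have e3 : ∀ c, opNorm (∑ t ∈ Finset.univ.filter
        (fun t : Fin k → Fin n => Function.Injective t), (J c t : ℂ) • sigmaTensor c t -
        ∑ i, cbsH c (w c i) (S c i)) ≤
        k ^ k * (2 ^ k * (δ * Real.sqrt ((n : ℝ) ^ k * (Lc k d' ^ 2 * E.card)))) := by
      intro c
      rw [e2, ← Finset.sum_sub_distrib]
      simp only [← sub_smul, ← Complex.ofReal_sub]
      exact cut_bound hk c _ _ (hcut c)
    refine (opNorm_sum_le _ _).trans ((Finset.sum_le_sum (fun c _ => e3 c)).trans (le_of_eq ?_))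
    have e4 : Real.sqrt ((n : ℝ) ^ k * (Lc k d' ^ 2 * E.card)) =
        (n : ℝ) ^ ((k : ℝ) / 2) * (Lc k d' * Real.sqrt E.card) := by
      rw [Real.sqrt_mul (by positivity), Real.sqrt_mul (by positivity), Real.sqrt_sq hL0.le]
      congr 1
      rw [Real.sqrt_eq_rpow, ← Real.rpow_natCast, ← Real.rpow_mul (by positivity)]
      congr 1
      ring
    rw [Finset.sum_const, nsmul_eq_mul, Finset.card_univ, ← hK, e4, hδ, hG]
    field_simp

end QLH
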